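/- Let k > 0 be an integer, n ≥ 3, and let x : Fin n → ℤ with Σ_i x_i = k·(n − 2). Then a genus-zero leaky cover datum for leaking k, degree x, and Psi-conditions e = 0 exists if and only if there exists an index i such that x_i is not a positive multiple of k/2, i.e. such that there is no integer m ≥ 1 with 2·x_i = m·k. -/

import Mathlib

/-- A genus-zero leaky cover datum for leaking `k`, degree `x : Fin n → ℤ` and
Psi-conditions `e : Fin n → ℕ`. The vertex set is `Fin N` with `N ≥ 1`; the tree
is encoded by the antisymmetric flow `w : Fin N → Fin N → ℤ` (two vertices are
adjacent iff the flow between them is nonzero); `a` assigns each of the `n` legs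
to a vertex. The valence of a vertex `v` is the number of neighbours plus the
number of legs at `v`; each vertex must satisfy the Psi-condition
`val v = (∑_{a i = v} e i) + 3` and the `k`-leaky balancing condition
`(∑_{a i = v} x i) + ∑_u w u v = k * (val v - 2)`. -/
structure LeakyCoverDatum (k : ℤ) {n : ℕ} (x : Fin n → ℤ) (e : Fin n → ℕ) : Type where
  /-- the number of vertices -/
  N : ℕ
  Npos : 0 < N
  /-- the leg assignment -/
  a : Fin n → Fin N
  /-- the flow on oriented pairs of vertices; nonzero exactly on edges of the tree -/
  w : Fin N → Fin N → ℤ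
  skew : ∀ u v, w u v = - w v u
  /-- the graph with an edge where the flow is nonzero is connected -/
  conn : (SimpleGraph.fromRel fun u v => w u v ≠ 0).Connected
  /-- the graph is a tree: the number of (unordered) edges is `N - 1`,
  counted here as ordered pairs -/
  tree : (Finset.univ.filter fun p : Fin N × Fin N => w p.1 p.2 ≠ 0).card = 2 * (N - 1)
  /-- the Psi-condition at each vertex -/
  psi : ∀ v : Fin N,
    (Finset.univ.filter fun u => w u v ≠ 0).card
      + (Finset.univ.filter fun i => a i = v).card
    = (∑ i ∈ Finset.univ.filter fun i => a i = v, e i) + 3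
  /-- the `k`-leaky balancing condition at each vertex -/
  balance : ∀ v : Fin N,
    (∑ i ∈ Finset.univ.filter fun i => a i = v, x i) + (∑ u, w u v)
    = k * ((((Finset.univ.filter fun u => w u v ≠ 0).card
        + (Finset.univ.filter fun i => a i = v).card : ℕ) : ℤ) - 2)

/-- A trivalent `k`-leaky cover on the vertex set `Fin N`, with legs indexed by the finset `s`. -/
structure IsTrivalentLeakyCover {ι : Type*} (k : ℤ) (s : Finset ι) (x : ι → ℤ) {N : ℕ}
    (a : ι → Fin N) (w : Fin N → Fin N → ℤ) : Prop where
  skew : ∀ u v, w u v = - w v u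
  conn : (SimpleGraph.fromRel fun u v => w u v ≠ 0).Connected
  tree : (Finset.univ.filter fun p : Fin N × Fin N => w p.1 p.2 ≠ 0).card = 2 * (N - 1)
  trivalent : ∀ v, (Finset.univ.filter fun u => w u v ≠ 0).card
    + (s.filter fun i => a i = v).card = 3
  balance : ∀ v, (∑ i ∈ s.filter fun i => a i = v, x i) + ∑ u, w u v = k

/-- The flow obtained by attaching a new vertex `0` to the vertex `c`, with flow `y` into `c`. -/
def attachFlow {N : ℕ} (w : Fin N → Fin N → ℤ) (c : Fin N) (y : ℤ) :
    Fin (N + 1) → Fin (N + 1) → ℤ :=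
  Fin.cons (Fin.cons 0 fun v => if v = c then y else 0)
    fun u => Fin.cons (if u = c then -y else 0) (w u)

section attachFlow

variable {N : ℕ} (w : Fin N → Fin N → ℤ) (c : Fin N) (y : ℤ)

@[simp] lemma attachFlow_zero_zero : attachFlow w c y 0 0 = 0 := rfl

@[simp] lemma attachFlow_zero_succ (v : Fin N) :
    attachFlow w c y 0 v.succ = if v = c then y else 0 := rfl

@[simp] lemma attachFlow_succ_zero (u : Fin N) :
    attachFlow w c y u.succ 0 = if u = c then -y else 0 := rfl

@[simp] lemma attachFlow_succ_succ (u v : Fin N) :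
    attachFlow w c y u.succ v.succ = w u v := rfl

lemma attachFlow_connected (hy : y ≠ 0)
    (h : (SimpleGraph.fromRel fun u v => w u v ≠ 0).Connected) :
    (SimpleGraph.fromRel fun u v => attachFlow w c y u v ≠ 0).Connected := by
  let f : (SimpleGraph.fromRel fun u v => w u v ≠ 0) →g
      (SimpleGraph.fromRel fun u v => attachFlow w c y u v ≠ 0) :=
    ⟨Fin.succ, fun {u v} huv => by simpa [SimpleGraph.fromRel_adj] using huv⟩
  rw [SimpleGraph.connected_iff_exists_forall_reachable]
  refine ⟨c.succ, Fin.cases ?_ fun v => (h.preconnected c v).map f⟩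
  refine SimpleGraph.Adj.reachable ?_
  simp [SimpleGraph.fromRel_adj, hy]

lemma card_attachFlow_zero (hy : y ≠ 0) :
    (Finset.univ.filter fun u => attachFlow w c y u 0 ≠ 0).card = 1 := by
  rw [Finset.card_eq_one]
  refine ⟨c.succ, ?_⟩
  ext u
  cases u using Fin.cases with
  | zero => simp [(Fin.succ_ne_zero _).symm]
  | succ u => simp [hy]

lemma card_attachFlow_succ (hy : y ≠ 0) (v : Fin N) :
    (Finset.univ.filter fun u => attachFlow w c y u v.succ ≠ 0).card
      = (if v = c then 1 else 0) + (Finset.univ.filter fun u => w u v ≠ 0).card := by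
  simp only [Finset.card_filter, Fin.sum_univ_succ]
  congr 1
  by_cases hv : v = c <;> simp [hv, hy]

lemma sum_attachFlow_succ (v : Fin N) :
    ∑ u, attachFlow w c y u v.succ = (if v = c then y else 0) + ∑ u, w u v := by
  simp [Fin.sum_univ_succ]

end attachFlow

lemma card_flow_ne_zero {V : Type*} [Fintype V] (w : V → V → ℤ) :
    (Finset.univ.filter fun p : V × V => w p.1 p.2 ≠ 0).card
      = ∑ v, (Finset.univ.filter fun u => w u v ≠ 0).card := by
  simp_rw [Finset.card_filter, Fintype.sum_prod_type_right]

lemma IsTrivalentLeakyCover.attach {ι : Type*} [DecidableEq ι] {k : ℤ} {t : Finset ι}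
    {x : ι → ℤ} {i j : ι} (hij : i ≠ j) (hi : i ∉ t) (hj : j ∉ t) (hne : x i + x j ≠ k)
    {N : ℕ} {a : ι → Fin N} {w : Fin N → Fin N → ℤ}
    (h : IsTrivalentLeakyCover k (insert i t) (Function.update x i (x i + x j - k)) a w) :
    IsTrivalentLeakyCover k (insert i (insert j t)) x
      (fun l => if l = i ∨ l = j then 0 else (a l).succ)
      (attachFlow w (a i) (x i + x j - k)) := by
  have hy : x i + x j - k ≠ 0 := sub_ne_zero.2 hne
  have hzero : ((insert i (insert j t)).filter fun l =>
      (if l = i ∨ l = j then 0 else (a l).succ) = 0) = {i, j} := by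
    ext l
    by_cases hli : l = i <;> by_cases hlj : l = j <;> simp [hli, hlj]
  have hsucc (v : Fin N) : ((insert i (insert j t)).filter fun l =>
      (if l = i ∨ l = j then 0 else (a l).succ) = v.succ) = t.filter fun l => a l = v := by
    ext l
    by_cases hli : l = i <;> by_cases hlj : l = j <;>
      simp [hli, hlj, hi, hj, (Fin.succ_ne_zero _).symm]
  have hupdate (v : Fin N) : ∑ l ∈ t.filter (fun l => a l = v),
      Function.update x i (x i + x j - k) l = ∑ l ∈ t.filter (fun l => a l = v), x l :=
    Finset.sum_update_of_notMem (by simp [hi]) _ _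
  refine ⟨?_, attachFlow_connected w _ _ hy h.conn, ?_, ?_, ?_⟩
  · refine Fin.cases (Fin.cases (by simp) fun v => ?_) fun u => Fin.cases ?_ fun v => ?_
    · by_cases hv : v = a i <;> simp [hv]
    · by_cases hv : u = a i <;> simp [hv]
    · simpa using h.skew u v
  · have hN : 0 < N := (a i).pos
    rw [card_flow_ne_zero, Fin.sum_univ_succ, card_attachFlow_zero w _ _ hy]
    simp_rw [card_attachFlow_succ w _ _ hy, Finset.sum_add_distrib]
    rw [← card_flow_ne_zero, h.tree, Finset.sum_ite_eq' Finset.univ (a i),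
      if_pos (Finset.mem_univ _)]
    omega
  · refine Fin.cases ?_ fun v => ?_
    · rw [hzero, Finset.card_pair hij, card_attachFlow_zero w _ _ hy]
    · have hv := h.trivalent v
      rw [Finset.filter_insert] at hv
      rw [hsucc, card_attachFlow_succ w _ _ hy]
      by_cases hva : a i = v
      · rw [if_pos hva, Finset.card_insert_of_notMem (by simp [hi])] at hv
        rw [if_pos hva.symm]
        omega
      · rw [if_neg hva] at hv
        rw [if_neg (Ne.symm hva), zero_add, hv]
  · refine Fin.cases ?_ fun v => ?_
    · rw [hzero, Finset.sum_pair hij, Fin.sum_univ_succ]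
      simp
    · have hv := h.balance v
      rw [Finset.filter_insert] at hv
      rw [hsucc, sum_attachFlow_succ]
      by_cases hva : a i = v
      · rw [if_pos hva, Finset.sum_insert (by simp [hi]), hupdate, Function.update_self] at hv
        rw [if_pos hva.symm]
        linarith
      · rw [if_neg hva, hupdate] at hv
        rw [if_neg (Ne.symm hva), zero_add, hv]

lemma isTrivalentLeakyCover_of_card_eq_three {ι : Type*} {k : ℤ} {s : Finset ι} {x : ι → ℤ}
    (hs : s.card = 3) (hx : ∑ i ∈ s, x i = k) :
    IsTrivalentLeakyCover k s x (N := 1) (fun _ => 0) (fun _ _ => 0) := by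
  refine ⟨by simp, ?_, by simp, fun v => ?_, fun v => ?_⟩
  · exact (SimpleGraph.connected_iff _).2 ⟨.of_subsingleton, inferInstance⟩
  · simp [Subsingleton.elim v 0, hs]
  · simp [Subsingleton.elim v 0, hx]

/-- If a leg of degree `x b` is not a positive multiple of `k / 2`, some two of the other legs
have degrees not summing to `k`. -/
lemma exists_pair_add_ne {ι : Type*} [DecidableEq ι] {k : ℤ} {s : Finset ι} {x : ι → ℤ}
    {b : ι} (hb : b ∈ s) (hs : 4 ≤ s.card) (hx : ∑ i ∈ s, x i = k * ((s.card : ℤ) - 2))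
    (hbad : ¬ ∃ m : ℤ, 1 ≤ m ∧ 2 * x b = m * k) :
    ∃ i ∈ s.erase b, ∃ j ∈ s.erase b, i ≠ j ∧ x i + x j ≠ k := by
  by_contra! hcon
  have hcard : (s.erase b).card = s.card - 1 := Finset.card_erase_of_mem hb
  have hhalf : ∀ i ∈ s.erase b, 2 * x i = k := by
    intro i hi
    have h1 : ((s.erase b).erase i).card = s.card - 1 - 1 := by
      rw [Finset.card_erase_of_mem hi, hcard]
    obtain ⟨p, hp, q, hq, hpq⟩ := Finset.one_lt_card.1 (by omega : 1 < ((s.erase b).erase i).card)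
    rw [Finset.mem_erase] at hp hq
    linarith [hcon i hi p hp.2 hp.1.symm, hcon i hi q hq.2 hq.1.symm, hcon p hp.2 q hq.2 hpq]
  have hsum : 2 * ∑ i ∈ s.erase b, x i = ((s.card : ℤ) - 1) * k := by
    rw [Finset.mul_sum, Finset.sum_congr rfl hhalf, Finset.sum_const, hcard, nsmul_eq_mul]
    push_cast [Nat.cast_sub (by omega : 1 ≤ s.card)]
    ring
  refine hbad ⟨s.card - 3, by omega, ?_⟩
  rw [← Finset.add_sum_erase s x hb] at hx
  linarith

lemma exists_isTrivalentLeakyCover {ι : Type*} [DecidableEq ι] {k : ℤ} {s : Finset ι}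
    {x : ι → ℤ} {b : ι} (hb : b ∈ s) (hs : 3 ≤ s.card)
    (hx : ∑ i ∈ s, x i = k * ((s.card : ℤ) - 2))
    (hbad : ¬ ∃ m : ℤ, 1 ≤ m ∧ 2 * x b = m * k) :
    ∃ (N : ℕ) (a : ι → Fin N) (w : Fin N → Fin N → ℤ), IsTrivalentLeakyCover k s x a w := by
  generalize hn : s.card = n at hs
  induction n, hs using Nat.le_induction generalizing s x with
  | base =>
    exact ⟨1, _, _, isTrivalentLeakyCover_of_card_eq_three hn (by rw [hx, hn]; norm_num)⟩
  | succ n hn3 ih =>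
    obtain ⟨i, hi, j, hj, hij, hne⟩ := exists_pair_add_ne hb (by omega) hx hbad
    rw [Finset.mem_erase] at hi hj
    obtain ⟨t, hit, rfl⟩ : ∃ t, i ∉ t ∧ insert i t = s :=
      ⟨s.erase i, by simp, Finset.insert_erase hi.2⟩
    obtain ⟨t, hjt, rfl⟩ : ∃ t', j ∉ t' ∧ insert j t' = t :=
      ⟨t.erase j, by simp, Finset.insert_erase (by simpa [hij.symm] using hj.2)⟩
    have hit' : i ∉ t := fun h => hit (Finset.mem_insert_of_mem h)
    have hbt : b ∈ insert i t := by simpa [hi.1.symm, hj.1.symm] using hb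
    have hcard : (insert i t).card = n := by
      rw [Finset.card_insert_of_notMem hit, Finset.card_insert_of_notMem hjt] at hn
      rw [Finset.card_insert_of_notMem hit']
      omega
    obtain ⟨N, a, w, h⟩ := ih (x := Function.update x i (x i + x j - k)) hbt
      (by
        rw [hn, Finset.sum_insert hit, Finset.sum_insert hjt] at hx
        rw [hcard, Finset.sum_insert hit', Finset.sum_update_of_notMem hit', Function.update_self]
        push_cast at hx
        linarith)
      (by rwa [Function.update_of_ne hi.1.symm]) hcard
    exact ⟨N + 1, _, _, h.attach hij hit' hjt hne⟩

/-- On an acyclic graph, a flow whose divergence is everywhere divisible by `k` is itself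
divisible by `k`. -/
lemma dvd_flow_of_dvd_divergence {V : Type*} [Fintype V] {G : SimpleGraph V}
    (hG : G.IsAcyclic) {k : ℤ} {f : V → V → ℤ} (hskew : ∀ u v, f u v = - f v u)
    (hadj : ∀ u v, f u v ≠ 0 → G.Adj u v) (hdiv : ∀ v, k ∣ ∑ u, f u v) (u v : V) :
    k ∣ f u v := by
  classical
  by_cases huv : f u v = 0
  · simp [huv]
  have hbridge := SimpleGraph.isAcyclic_iff_forall_adj_isBridge.1 hG (hadj u v huv)
  rw [SimpleGraph.isBridge_iff] at hbridge
  let H := G.deleteEdges {s(u, v)}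
  let S : Finset V := Finset.univ.filter (H.Reachable v)
  have hu : u ∉ S := by
    intro h
    exact hbridge (Finset.mem_filter.1 h).2.symm
  have hv : v ∈ S := by simp [S]
  have hcross : ∀ p ∉ S, ∀ q ∈ S, ¬(p = u ∧ q = v) → f p q = 0 := by
    intro p hp q hq hpq
    by_contra hne
    have hreach : H.Reachable v q := (Finset.mem_filter.1 hq).2
    refine hp (Finset.mem_filter.2 ⟨Finset.mem_univ _, hreach.trans ?_⟩)
    refine SimpleGraph.Adj.reachable ?_
    rw [SimpleGraph.deleteEdges_adj]
    refine ⟨(hadj p q hne).symm, ?_⟩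
    rw [Set.mem_singleton_iff, Sym2.eq_iff]
    rintro (⟨rfl, rfl⟩ | ⟨rfl, rfl⟩)
    · exact hu hq
    · exact hpq ⟨rfl, rfl⟩
  have hin : ∑ q ∈ S, ∑ p ∈ S, f p q = 0 := by
    have h1 : ∑ q ∈ S, ∑ p ∈ S, f p q = - ∑ q ∈ S, ∑ p ∈ S, f p q := by
      conv_rhs => rw [Finset.sum_comm]
      simp only [← Finset.sum_neg_distrib, ← hskew]
    omega
  have hout : ∑ q ∈ S, ∑ p ∈ Sᶜ, f p q = f u v := by
    rw [Finset.sum_eq_single_of_mem v hv, Finset.sum_eq_single_of_mem u (by simpa using hu)]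
    · exact fun p hp hpu => hcross p (by simpa using hp) v hv fun h => hpu h.1
    · exact fun q hq hqv => Finset.sum_eq_zero fun p hp =>
        hcross p (by simpa using hp) q hq fun h => hqv h.2
  have htot : ∑ q ∈ S, ∑ p, f p q = f u v := by
    simp_rw [← Finset.sum_add_sum_compl S, Finset.sum_add_distrib]
    rw [hin, hout, zero_add]
  exact htot ▸ Finset.dvd_sum fun q _ => hdiv q

/-- A skew-symmetric flow has exactly half of its nonzero entries negative. -/
lemma two_mul_card_neg_of_skew {V : Type*} [Fintype V] {w : V → V → ℤ}
    (hskew : ∀ u v, w u v = - w v u) :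
    2 * (Finset.univ.filter fun p : V × V => w p.1 p.2 < 0).card
      = (Finset.univ.filter fun p : V × V => w p.1 p.2 ≠ 0).card := by
  classical
  have hswap : (Finset.univ.filter fun p : V × V => w p.1 p.2 < 0).card
      = (Finset.univ.filter fun p : V × V => 0 < w p.1 p.2).card := by
    refine Finset.card_equiv (Equiv.prodComm V V) fun p => ?_
    have := hskew p.1 p.2
    simp only [Finset.mem_filter, Finset.mem_univ, true_and, Equiv.prodComm_apply,
      Prod.fst_swap, Prod.snd_swap]
    omega
  simp_rw [ne_iff_lt_or_gt, Finset.filter_or]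
  rw [Finset.card_union_of_disjoint, two_mul]
  · exact congrArg _ hswap
  · rw [Finset.disjoint_filter]
    intro p _ h1 h2
    omega

lemma fromRel_flow_adj {V : Type*} {w : V → V → ℤ} (hskew : ∀ u v, w u v = - w v u) (u v : V) :
    (SimpleGraph.fromRel fun u v => w u v ≠ 0).Adj u v ↔ w u v ≠ 0 := by
  have h1 := hskew u v
  rw [SimpleGraph.fromRel_adj]
  constructor
  · rintro ⟨-, h | h⟩ <;> omega
  · refine fun h => ⟨?_, Or.inl h⟩
    rintro rfl
    omega

lemma isTree_of_flow {N : ℕ} {w : Fin N → Fin N → ℤ} (hskew : ∀ u v, w u v = - w v u)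
    (hconn : (SimpleGraph.fromRel fun u v => w u v ≠ 0).Connected)
    (hcard : (Finset.univ.filter fun p : Fin N × Fin N => w p.1 p.2 ≠ 0).card = 2 * (N - 1)) :
    (SimpleGraph.fromRel fun u v => w u v ≠ 0).IsTree := by
  classical
  set G := SimpleGraph.fromRel fun u v => w u v ≠ 0
  have hN : 0 < N := Fin.pos_iff_nonempty.2 hconn.nonempty
  have hdeg := G.sum_degrees_eq_twice_card_edges
  have hdeg' : ∑ v, G.degree v = 2 * (N - 1) := by
    rw [← hcard, Finset.card_filter, Fintype.sum_prod_type]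
    refine Finset.sum_congr rfl fun v _ => ?_
    rw [← Finset.card_filter, ← G.card_neighborFinset_eq_degree]
    congr 1
    ext u
    rw [SimpleGraph.mem_neighborFinset, fromRel_flow_adj hskew]
    simp
  refine SimpleGraph.isTree_iff_connected_and_card.2 ⟨hconn, ?_⟩
  rw [Nat.card_eq_fintype_card, ← SimpleGraph.edgeFinset_card, Nat.card_eq_fintype_card,
    Fintype.card_fin]
  omega

lemma IsTrivalentLeakyCover.exists_not_pos_multiple {ι : Type*} {k : ℤ} (hk : 0 < k)
    {s : Finset ι} {x : ι → ℤ} {N : ℕ} {a : ι → Fin N} {w : Fin N → Fin N → ℤ}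
    (h : IsTrivalentLeakyCover k s x a w) :
    ∃ i ∈ s, ¬ ∃ m : ℤ, 1 ≤ m ∧ 2 * x i = m * k := by
  by_contra! hall
  have hN : 0 < N := Fin.pos_iff_nonempty.2 h.conn.nonempty
  have hdvd : ∀ u v, k ∣ 2 * w u v := by
    refine dvd_flow_of_dvd_divergence (isTree_of_flow h.skew h.conn h.tree).isAcyclic
      (fun u v => by rw [h.skew u v]; ring)
      (fun u v huv => (fromRel_flow_adj h.skew u v).2 fun h0 => huv (by simp [h0])) fun v => ?_
    have hlegs : k ∣ ∑ i ∈ s.filter fun i => a i = v, 2 * x i :=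
      Finset.dvd_sum fun i hi => by
        obtain ⟨m, -, hm⟩ := hall i (Finset.mem_filter.1 hi).1
        exact ⟨m, by rw [hm, mul_comm]⟩
    have hbal := h.balance v
    rw [← Finset.mul_sum] at hlegs ⊢
    rw [show 2 * ∑ u, w u v = 2 * k - 2 * ∑ i ∈ s.filter fun i => a i = v, x i by linarith]
    exact dvd_sub (dvd_mul_left _ _) hlegs
  have hneg : ∀ v, ∃ u, w u v < 0 := by
    intro v
    by_contra! hnonneg
    have hlegs : ∑ i ∈ s.filter (fun i => a i = v), k
        ≤ ∑ i ∈ s.filter (fun i => a i = v), 2 * x i :=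
      Finset.sum_le_sum fun i hi => by
        obtain ⟨m, hm1, hm⟩ := hall i (Finset.mem_filter.1 hi).1
        nlinarith
    have hedges : ∑ u ∈ Finset.univ.filter (fun u => w u v ≠ 0), k ≤ ∑ u, 2 * w u v := by
      rw [Finset.sum_filter]
      refine Finset.sum_le_sum fun u _ => ?_
      split_ifs with hu
      · exact Int.le_of_dvd (by have := hnonneg u; omega) (hdvd u v)
      · simpa using hnonneg u
    rw [Finset.sum_const, nsmul_eq_mul, ← Finset.mul_sum] at hlegs hedges
    have hval : (((Finset.univ.filter fun u => w u v ≠ 0).card : ℕ) : ℤ)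
        + ((s.filter fun i => a i = v).card : ℕ) = 3 := by exact_mod_cast h.trivalent v
    have hbal := h.balance v
    have : 3 * k ≤ 2 * k := by rw [← hval, add_mul]; linarith
    omega
  choose f hf using hneg
  have hle : N ≤ (Finset.univ.filter fun p : Fin N × Fin N => w p.1 p.2 < 0).card := by
    have := Finset.card_le_card_of_injOn (s := (Finset.univ : Finset (Fin N)))
      (t := Finset.univ.filter fun p : Fin N × Fin N => w p.1 p.2 < 0) (fun v => (f v, v))
      (fun v _ => by simpa using hf v) (fun u _ v _ huv => (Prod.ext_iff.1 huv).2)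
    simpa using this
  have htwo := two_mul_card_neg_of_skew h.skew
  rw [h.tree] at htwo
  omega

lemma nonempty_leakyCoverDatum_iff {k : ℤ} {n : ℕ} {x : Fin n → ℤ} :
    Nonempty (LeakyCoverDatum k x (fun _ => 0)) ↔
      ∃ (N : ℕ) (a : Fin n → Fin N) (w : Fin N → Fin N → ℤ),
        IsTrivalentLeakyCover k Finset.univ x a w := by
  constructor
  · rintro ⟨D⟩
    have hval v := (D.psi v).trans (by simp : _ = 3)
    refine ⟨D.N, D.a, D.w, D.skew, D.conn, D.tree, hval, fun v => ?_⟩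
    rw [D.balance v, hval v]
    norm_num
  · rintro ⟨N, a, w, h⟩
    exact ⟨⟨N, Fin.pos_iff_nonempty.2 h.conn.nonempty, a, w, h.skew, h.conn, h.tree,
      fun v => by simpa using h.trivalent v,
      fun v => by rw [h.balance v, h.trivalent v]; norm_num⟩⟩

/-- Let `k > 0`, `n ≥ 3`, and `x : Fin n → ℤ` with
`∑ x i = k * (n - 2)`. Then a genus-zero leaky cover datum for leaking `k`,
degree `x`, and Psi-conditions `e = 0` exists if and only if some entry
`x i` is not a positive multiple of `k/2` (integrally: there is no integer
`m ≥ 1` with `2 * x i = m * k`). -/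
theorem leaky_hurwitz_positivity_criterion (k : ℤ) (hk : 0 < k)
    (n : ℕ) (hn : 3 ≤ n) (x : Fin n → ℤ)
    (hsum : ∑ i, x i = k * ((n : ℤ) - 2)) :
    Nonempty (LeakyCoverDatum k x (fun _ => 0)) ↔
      ∃ i : Fin n, ¬ ∃ m : ℤ, 1 ≤ m ∧ 2 * x i = m * k := by
  rw [nonempty_leakyCoverDatum_iff]
  constructor
  · rintro ⟨N, a, w, h⟩
    obtain ⟨i, -, hi⟩ := h.exists_not_pos_multiple hk
    exact ⟨i, hi⟩
  · rintro ⟨b, hb⟩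
    exact exists_isTrivalentLeakyCover (Finset.mem_univ b) (by simpa using hn)
      (by simpa using hsum) hb
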